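/- Let 𝒳 = B_1 × ⋯ × B_s be a degenerate affine space over a field K of characteristic p, assume p divides e_i = |B_i| for all i, and let r_0 = ∑_{i=1}^s (e_i − 1). Then C_𝒳(d)^⊥ = C_𝒳(r_0 − d − 1) for all −1 ≤ d < r_0, and C_𝒳(r_0)^⊥ = (0). -/

import Mathlib

open MvPolynomial

noncomputable section

variable {K : Type*} [Field K] {s m : ℕ}

/-- Evaluation linear map at a family of points. -/
def evalMap (P : Fin m → (Fin s → K)) :
    MvPolynomial (Fin s) K →ₗ[K] (Fin m → K) :=
  LinearMap.pi fun i => (MvPolynomial.aeval (P i)).toLinearMap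

/-- Vanishing ideal of a finite family of points. -/
def vanishingIdeal (P : Fin m → (Fin s → K)) : Ideal (MvPolynomial (Fin s) K) :=
  ⨅ i, RingHom.ker (MvPolynomial.eval (P i))

/-- The linear map `φ : f ↦ ∑ i, f(P i)`. -/
def sumEval (P : Fin m → (Fin s → K)) : MvPolynomial (Fin s) K →ₗ[K] K :=
  ∑ i, (MvPolynomial.aeval (P i)).toLinearMap

/-- The leading exponent (initial monomial exponent) of a polynomial w.r.t. a monomial order. -/
def leadExpo (mo : MonomialOrder (Fin s)) (f : MvPolynomial (Fin s) K) : Fin s →₀ ℕ :=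
  mo.toSyn.symm (f.support.sup fun a => mo.toSyn a)

/-- The initial ideal of `I` w.r.t. a monomial order. -/
def initialIdeal (mo : MonomialOrder (Fin s)) (I : Ideal (MvPolynomial (Fin s) K)) :
    Ideal (MvPolynomial (Fin s) K) :=
  Ideal.span ((fun f => (monomial (leadExpo mo f) (1 : K))) '' {f | f ∈ I ∧ f ≠ 0})

/-- The set of exponents of standard monomials of `S/I`. -/
def stdMon (mo : MonomialOrder (Fin s)) (I : Ideal (MvPolynomial (Fin s) K)) :
    Set (Fin s →₀ ℕ) :=
  {a | monomial a (1 : K) ∉ initialIdeal mo I}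

/-- `K Δ_≺(I)`, the span of the standard monomials. -/
def stdSpan (mo : MonomialOrder (Fin s)) (I : Ideal (MvPolynomial (Fin s) K)) :
    Submodule K (MvPolynomial (Fin s) K) :=
  Submodule.span K ((fun a => monomial a (1 : K)) '' stdMon mo I)

/-- The space `(ker φ : L) = {g | g·f ∈ ker φ for all f ∈ L}`. -/
def colonKer (φ : MvPolynomial (Fin s) K →ₗ[K] K)
    (L : Submodule K (MvPolynomial (Fin s) K)) : Submodule K (MvPolynomial (Fin s) K) where
  carrier := {g | ∀ f ∈ L, φ (g * f) = 0}
  add_mem' := fun ha hb f hf => by rw [add_mul, map_add, ha f hf, hb f hf, add_zero]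
  zero_mem' := fun f hf => by rw [zero_mul, map_zero]
  smul_mem' := fun c a ha f hf => by rw [smul_mul_assoc, map_smul, ha f hf, smul_zero]

/-- The algebraic dual `L^⊥ = (ker φ : L) ∩ KΔ_≺(I)`. -/
def algDual (P : Fin m → (Fin s → K)) (mo : MonomialOrder (Fin s))
    (L : Submodule K (MvPolynomial (Fin s) K)) : Submodule K (MvPolynomial (Fin s) K) :=
  colonKer (sumEval P) L ⊓ stdSpan mo (vanishingIdeal P)

/-- The dual of a linear code in `K^m`. -/
def dualCode (C : Submodule K (Fin m → K)) : Submodule K (Fin m → K) where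
  carrier := {α | ∀ β ∈ C, ∑ i, α i * β i = 0}
  add_mem' := fun ha hb β hβ => by
    simp only [Pi.add_apply, add_mul, Finset.sum_add_distrib]
    rw [ha β hβ, hb β hβ, add_zero]
  zero_mem' := fun β hβ => by simp
  smul_mem' := fun c a ha β hβ => by
    simp only [Pi.smul_apply, smul_eq_mul, mul_assoc, ← Finset.mul_sum]
    rw [ha β hβ, mul_zero]

/-- Coordinatewise scaling of `K^m` by a vector `β`. -/
def scaleMap (β : Fin m → K) : (Fin m → K) →ₗ[K] (Fin m → K) :=
  LinearMap.pi fun i => β i • LinearMap.proj i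

/-- A monomial order is graded if it refines total degree. -/
def MonomialOrder.IsGraded (mo : MonomialOrder (Fin s)) : Prop :=
  ∀ a b : Fin s →₀ ℕ, Finsupp.degree a < Finsupp.degree b → mo.toSyn a < mo.toSyn b

/-- The affine Hilbert function of the vanishing ideal of the points `P`. -/
def hilbA (P : Fin m → (Fin s → K)) (d : ℕ) : ℕ :=
  Module.finrank K
    (Submodule.map (Ideal.Quotient.mkₐ K (vanishingIdeal P)).toLinearMap
      (restrictTotalDegree (Fin s) K d))

/-- The affine Hilbert function, with `H(d) = 0` for `d < 0`. -/
def hilbAZ (P : Fin m → (Fin s → K)) (d : ℤ) : ℕ :=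
  if d < 0 then 0 else hilbA P d.toNat

/-- The Reed–Muller-type code of degree `d` on the points `P`. -/
def RMcode (P : Fin m → (Fin s → K)) (d : ℕ) : Submodule K (Fin m → K) :=
  Submodule.map (evalMap P) (restrictTotalDegree (Fin s) K d)

/-- The Reed–Muller-type code indexed by an integer degree, `⊥` for `d < 0`. -/
def RMcodeZ (P : Fin m → (Fin s → K)) (d : ℤ) : Submodule K (Fin m → K) :=
  if d < 0 then ⊥ else RMcode P d.toNat

/-- The vanishing ideal of a single point. -/
def pointIdeal (Q : Fin s → K) : Ideal (MvPolynomial (Fin s) K) :=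
  RingHom.ker (MvPolynomial.eval Q)

/-- The local v-number `v_𝔭(I)`. -/
def vNumAt (I 𝔭 : Ideal (MvPolynomial (Fin s) K)) : ℕ :=
  sInf {d | ∃ f : MvPolynomial (Fin s) K, f ≠ 0 ∧ f.totalDegree = d ∧
    I.colon (Ideal.span {f}) = 𝔭}

/-- `f` is an indicator function for the `i`-th point. -/
def IsIndicator (P : Fin m → (Fin s → K)) (f : MvPolynomial (Fin s) K) (i : Fin m) : Prop :=
  MvPolynomial.eval (P i) f ≠ 0 ∧ ∀ j, j ≠ i → MvPolynomial.eval (P j) f = 0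

/-- The minimum distance of a linear code. -/
def minDist (C : Submodule K (Fin m → K)) : ℕ :=
  sInf {w | ∃ v ∈ C, v ≠ 0 ∧ Set.ncard {i | v i ≠ 0} = w}

section PowerSums

variable [Fintype K]

open scoped Classical in
/-- The finite set `G ∪ {0}` attached to a subgroup `G` of `Kˣ`. -/
def insertZero (G : Subgroup Kˣ) : Finset K :=
  insert 0 (Finset.univ.image fun u : G => ((u : Kˣ) : K))

lemma mem_insertZero {G : Subgroup Kˣ} {x : K} :
    x ∈ insertZero G ↔ x = 0 ∨ ∃ u ∈ G, (u : K) = x := by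
  simp [insertZero]

open scoped Classical in
lemma sum_insertZero (G : Subgroup Kˣ) {M : Type*} [AddCommMonoid M] (f : K → M) :
    ∑ x ∈ insertZero G, f x = f 0 + ∑ u : G, f ((u : Kˣ) : K) := by
  rw [insertZero, Finset.sum_insert (by simp), Finset.sum_image]
  intro u _ v _ h
  exact Subtype.ext (Units.ext h)

lemma card_insertZero (G : Subgroup Kˣ) : (insertZero G).card = Nat.card G + 1 := by
  classical
  rw [Finset.card_eq_sum_ones, sum_insertZero, ← Finset.card_eq_sum_ones, Finset.card_univ,
    ← Nat.card_eq_fintype_card, add_comm]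

lemma sum_insertZero_pow_eq_zero {G : Subgroup Kˣ} (hG : ((Nat.card G + 1 : ℕ) : K) = 0)
    {k : ℕ} (hk : k < Nat.card G) : ∑ x ∈ insertZero G, x ^ k = 0 := by
  classical
  rcases eq_or_ne k 0 with rfl | hk0
  · simpa [card_insertZero] using hG
  · rw [sum_insertZero, zero_pow hk0, zero_add]
    exact FiniteField.sum_subgroup_pow_eq_zero hk0 (by rwa [← Nat.card_eq_fintype_card])

lemma sum_insertZero_pow_card {G : Subgroup Kˣ} (hG : ((Nat.card G + 1 : ℕ) : K) = 0) :
    ∑ x ∈ insertZero G, x ^ Nat.card G = -1 := by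
  classical
  have hpow (u : G) : ((u : Kˣ) : K) ^ Nat.card G = 1 := by
    rw [← Units.val_pow_eq_pow_val, ← Subgroup.coe_pow, pow_card_eq_one', Subgroup.coe_one,
      Units.val_one]
  rw [sum_insertZero, zero_pow Nat.card_pos.ne', zero_add]
  simp only [hpow, Finset.sum_const, Finset.card_univ, nsmul_eq_mul, mul_one,
    ← Nat.card_eq_fintype_card]
  push_cast at hG
  exact eq_neg_of_add_eq_zero_left hG

variable {A : Fin s → Subgroup Kˣ}

lemma sum_piFinset_prod_pow_eq_zero (hA : ∀ i, ((Nat.card (A i) + 1 : ℕ) : K) = 0)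
    {a : Fin s → ℕ} {i : Fin s} (hi : a i < Nat.card (A i)) :
    ∑ x ∈ Fintype.piFinset (fun i => insertZero (A i)), ∏ i, x i ^ a i = 0 := by
  rw [← Finset.prod_univ_sum (fun i => insertZero (A i)) (fun i x => x ^ a i)]
  exact Finset.prod_eq_zero (Finset.mem_univ i) (sum_insertZero_pow_eq_zero (hA i) hi)

lemma sum_piFinset_prod_pow_card_ne_zero (hA : ∀ i, ((Nat.card (A i) + 1 : ℕ) : K) = 0) :
    ∑ x ∈ Fintype.piFinset (fun i => insertZero (A i)), ∏ i, x i ^ Nat.card (A i) ≠ 0 := by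
  rw [← Finset.prod_univ_sum (fun i => insertZero (A i)) (fun i x => x ^ Nat.card (A i))]
  simp [sum_insertZero_pow_card (hA _)]

lemma sum_piFinset_eval_eq_zero (hA : ∀ i, ((Nat.card (A i) + 1 : ℕ) : K) = 0)
    {f : MvPolynomial (Fin s) K} (hf : f.totalDegree < ∑ i, Nat.card (A i)) :
    ∑ x ∈ Fintype.piFinset (fun i => insertZero (A i)), eval x f = 0 := by
  simp only [eval_eq']
  rw [Finset.sum_comm]
  refine Finset.sum_eq_zero fun a ha => ?_
  obtain ⟨i, -, hi⟩ : ∃ i ∈ Finset.univ, a i < Nat.card (A i) := by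
    apply Finset.exists_lt_of_sum_lt
    rw [← Finsupp.degree_eq_sum]
    exact (le_totalDegree ha).trans_lt hf
  rw [← Finset.mul_sum, sum_piFinset_prod_pow_eq_zero hA hi, mul_zero]

end PowerSums

lemma evalMap_apply (P : Fin m → Fin s → K) (f : MvPolynomial (Fin s) K) (j : Fin m) :
    evalMap P f j = eval (P j) f := by
  simp [evalMap, aeval_eq_eval]

/-- Every function on the finitely many points of a product of finite sets is the evaluation of a
polynomial whose degree in each variable is smaller than the size of the corresponding factor. -/
lemma exists_degreeOf_le_evalMap_eq {P : Fin m → Fin s → K} (hP : Function.Injective P)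
    {B : Fin s → Finset K} (hB : ∀ j i, P j i ∈ B i) (α : Fin m → K) :
    ∃ g : MvPolynomial (Fin s) K, (∀ i, g.degreeOf i ≤ (B i).card - 1) ∧ evalMap P g = α := by
  classical
  let h (j : Fin m) : MvPolynomial (Fin s) K :=
    ∏ i, ∏ b ∈ (B i).erase (P j i), (X i - C b)
  have hself (j : Fin m) : eval (P j) (h j) ≠ 0 := by
    simp only [h, map_prod, map_sub, eval_X, eval_C, Finset.prod_ne_zero_iff]
    intro i _ b hb
    exact sub_ne_zero.2 (Finset.ne_of_mem_erase hb).symm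
  have hother (j k : Fin m) (hjk : k ≠ j) : eval (P k) (h j) = 0 := by
    obtain ⟨i, hi⟩ := Function.ne_iff.1 (hP.ne hjk)
    simp only [h, map_prod, map_sub, eval_X, eval_C]
    exact Finset.prod_eq_zero (Finset.mem_univ i)
      (Finset.prod_eq_zero (Finset.mem_erase.2 ⟨hi, hB k i⟩) (sub_self _))
  have hdeg (j : Fin m) (i : Fin s) : (h j).degreeOf i ≤ (B i).card - 1 := by
    refine (degreeOf_prod_le _ _ _).trans ?_
    rw [Finset.sum_eq_single i]
    · refine (degreeOf_prod_le _ _ _).trans ?_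
      rw [← Finset.card_erase_of_mem (hB j i), Finset.card_eq_sum_ones]
      refine Finset.sum_le_sum fun b _ => (degreeOf_sub_le _ _ _).trans ?_
      simp
    · intro k _ hk
      refine Nat.le_zero.1 ((degreeOf_prod_le _ _ _).trans (Finset.sum_nonpos fun b _ => ?_))
      refine (degreeOf_sub_le _ _ _).trans ?_
      simp [degreeOf_X_of_ne hk.symm]
    · simp
  refine ⟨∑ j, C (α j / eval (P j) (h j)) * h j, fun i => ?_, ?_⟩
  · exact (degreeOf_sum_le _ _ _).trans
      (Finset.sup_le fun j _ => (degreeOf_C_mul_le _ _ _).trans (hdeg j i))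
  · ext k
    simp only [evalMap_apply, map_sum, map_mul, eval_C]
    rw [Finset.sum_eq_single k (fun j _ hj => by rw [hother j k hj.symm, mul_zero]) (by simp),
      div_mul_cancel₀ _ (hself k)]

lemma mem_RMcode {P : Fin m → Fin s → K} {n : ℕ} {α : Fin m → K} :
    α ∈ RMcode P n ↔ ∃ f : MvPolynomial (Fin s) K, f.totalDegree ≤ n ∧ evalMap P f = α := by
  simp [RMcode, Submodule.mem_map, mem_restrictTotalDegree]

lemma mem_dualCode {D : Submodule K (Fin m → K)} {α : Fin m → K} :
    α ∈ dualCode D ↔ ∀ β ∈ D, ∑ i, α i * β i = 0 := Iff.rfl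

section DegenerateAffineSpace

variable [Fintype K] {A : Fin s → Subgroup Kˣ} {P : Fin m → Fin s → K}

lemma sum_eval_points (hP : Function.Injective P)
    (hrange : Set.range P = {x | ∀ i, x i = 0 ∨ ∃ u ∈ A i, (u : K) = x i})
    (f : MvPolynomial (Fin s) K) :
    ∑ j, eval (P j) f = ∑ x ∈ Fintype.piFinset (fun i => insertZero (A i)), eval x f := by
  classical
  have himage : Fintype.piFinset (fun i => insertZero (A i)) = Finset.univ.image P := by
    ext x
    have hx := Set.ext_iff.1 hrange x
    simp only [Set.mem_range, Set.mem_ofPred_eq] at hx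
    simp [mem_insertZero, hx]
  rw [himage, Finset.sum_image hP.injOn]

lemma RMcode_le_dualCode (hA : ∀ i, ((Nat.card (A i) + 1 : ℕ) : K) = 0)
    (hP : Function.Injective P)
    (hrange : Set.range P = {x | ∀ i, x i = 0 ∨ ∃ u ∈ A i, (u : K) = x i})
    {n k : ℕ} (hnk : n + k < ∑ i, Nat.card (A i)) : RMcode P k ≤ dualCode (RMcode P n) := by
  intro α hα β hβ
  obtain ⟨f, hf, rfl⟩ := mem_RMcode.1 hα
  obtain ⟨g, hg, rfl⟩ := mem_RMcode.1 hβ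
  simp only [evalMap_apply, ← map_mul]
  rw [sum_eval_points hP hrange]
  exact sum_piFinset_eval_eq_zero hA ((totalDegree_mul _ _).trans_lt (by omega))

/-- If a polynomial with small degree in each variable evaluates to a word orthogonal to the code
of degree `n`, then its total degree is smaller than `r₀ - n`. -/
lemma degree_add_lt_of_evalMap_mem_dualCode (hA : ∀ i, ((Nat.card (A i) + 1 : ℕ) : K) = 0)
    (hP : Function.Injective P)
    (hrange : Set.range P = {x | ∀ i, x i = 0 ∨ ∃ u ∈ A i, (u : K) = x i})
    {n : ℕ} {g : MvPolynomial (Fin s) K} (hg : ∀ i, g.degreeOf i ≤ Nat.card (A i))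
    (hdual : evalMap P g ∈ dualCode (RMcode P n)) {c : Fin s →₀ ℕ} (hc : c ∈ g.support) :
    c.degree + n < ∑ i, Nat.card (A i) := by
  obtain ⟨a, ha, hmax⟩ := g.support.exists_max_image Finsupp.degree ⟨c, hc⟩
  refine lt_of_le_of_lt (Nat.add_le_add_right (hmax c hc) n) ?_
  by_contra! hle
  have hale (i : Fin s) : a i ≤ Nat.card (A i) := degreeOf_le_iff.1 (hg i) a ha
  let b : Fin s →₀ ℕ := Finsupp.equivFunOnFinite.symm fun i => Nat.card (A i) - a i
  have hab (i : Fin s) : a i + b i = Nat.card (A i) := Nat.add_sub_of_le (hale i)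
  have hdegree : a.degree + b.degree = ∑ i, Nat.card (A i) := by
    simp only [Finsupp.degree_eq_sum, ← Finset.sum_add_distrib, hab]
  have hb : evalMap P (monomial b 1) ∈ RMcode P n :=
    mem_RMcode.2 ⟨_, (totalDegree_monomial_le _ _).trans (by
      change b.degree ≤ n
      omega), rfl⟩
  have hzero := mem_dualCode.1 hdual _ hb
  simp only [evalMap_apply, ← map_mul] at hzero
  rw [sum_eval_points hP hrange] at hzero
  simp only [map_mul, eval_eq' _ g, eval_monomial, one_mul, Finsupp.prod_pow, Finset.sum_mul,
    mul_assoc, ← Finset.prod_mul_distrib, ← pow_add] at hzero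
  rw [Finset.sum_comm, Finset.sum_eq_single_of_mem a ha] at hzero
  · simp only [← Finset.mul_sum, hab] at hzero
    exact mul_ne_zero (mem_support_iff.1 ha) (sum_piFinset_prod_pow_card_ne_zero hA) hzero
  · intro k hk hka
    obtain ⟨i, hi⟩ : ∃ i, k i < a i := by
      by_contra! hak
      refine hka (DFunLike.ext _ _ fun i => ?_)
      have hsum : ∑ i, a i = ∑ i, k i :=
        le_antisymm (Finset.sum_le_sum fun i _ => hak i) (by
          simpa only [Finsupp.degree_eq_sum] using hmax k hk)
      exact ((Finset.sum_eq_sum_iff_of_le fun i _ => hak i).1 hsum i (Finset.mem_univ i)).symm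
    have hlt : k i + b i < Nat.card (A i) := by
      have := hab i
      omega
    rw [← Finset.mul_sum, sum_piFinset_prod_pow_eq_zero (a := fun i => k i + b i) hA hlt, mul_zero]

lemma exists_degreeOf_le_card_evalMap_eq (hP : Function.Injective P)
    (hrange : Set.range P = {x | ∀ i, x i = 0 ∨ ∃ u ∈ A i, (u : K) = x i}) (α : Fin m → K) :
    ∃ g : MvPolynomial (Fin s) K, (∀ i, g.degreeOf i ≤ Nat.card (A i)) ∧ evalMap P g = α := by
  have hmem (j : Fin m) : P j ∈ {x | ∀ i, x i = 0 ∨ ∃ u ∈ A i, (u : K) = x i} :=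
    hrange ▸ Set.mem_range_self j
  simpa only [card_insertZero, Nat.add_sub_cancel] using
    exists_degreeOf_le_evalMap_eq hP (fun j i => mem_insertZero.2 (hmem j i)) α

lemma RMcode_sum_card_eq_top (hP : Function.Injective P)
    (hrange : Set.range P = {x | ∀ i, x i = 0 ∨ ∃ u ∈ A i, (u : K) = x i}) :
    RMcode P (∑ i, Nat.card (A i)) = ⊤ := by
  refine eq_top_iff.2 fun α _ => ?_
  obtain ⟨g, hg, rfl⟩ := exists_degreeOf_le_card_evalMap_eq hP hrange α
  refine mem_RMcode.2 ⟨g, Finset.sup_le fun a ha => ?_, rfl⟩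
  change a.degree ≤ _
  rw [Finsupp.degree_eq_sum]
  exact Finset.sum_le_sum fun i _ => degreeOf_le_iff.1 (hg i) a ha

lemma dualCode_RMcode (hA : ∀ i, ((Nat.card (A i) + 1 : ℕ) : K) = 0)
    (hP : Function.Injective P)
    (hrange : Set.range P = {x | ∀ i, x i = 0 ∨ ∃ u ∈ A i, (u : K) = x i})
    {n : ℕ} (hn : n < ∑ i, Nat.card (A i)) :
    dualCode (RMcode P n) = RMcode P (∑ i, Nat.card (A i) - n - 1) := by
  refine le_antisymm (fun α hα => ?_) (RMcode_le_dualCode hA hP hrange (by omega))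
  obtain ⟨g, hg, rfl⟩ := exists_degreeOf_le_card_evalMap_eq hP hrange α
  refine mem_RMcode.2 ⟨g, Finset.sup_le fun a ha => ?_, rfl⟩
  have := degree_add_lt_of_evalMap_mem_dualCode hA hP hrange hg hα ha
  change a.degree ≤ _
  omega

end DegenerateAffineSpace

lemma dualCode_bot : dualCode (⊥ : Submodule K (Fin m → K)) = ⊤ :=
  eq_top_iff.2 fun α _ => mem_dualCode.2 fun β hβ => by simp [(Submodule.mem_bot K).1 hβ]

lemma dualCode_top : dualCode (⊤ : Submodule K (Fin m → K)) = ⊥ := by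
  classical
  refine eq_bot_iff.2 fun α hα => (Submodule.mem_bot K).2 (funext fun i => ?_)
  simpa [Pi.single_apply] using mem_dualCode.1 hα (Pi.single i 1) trivial

/-- Over a degenerate affine space with `char K` dividing every `eᵢ`, the dual of the
Reed–Muller-type code of degree `d` equals the one of degree `r₀ - d - 1`. -/
theorem dual_RM_degenerate_affine_space [Fintype K] (p : ℕ) (hp : p.Prime) (hchar : CharP K p)
    (A : Fin s → Subgroup Kˣ) (d : Fin s → ℕ) (hd : ∀ i, d i = Nat.card (A i))
    (e : Fin s → ℕ) (he : ∀ i, e i = d i + 1) (hpe : ∀ i, p ∣ e i)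
    (P : Fin m → (Fin s → K)) (hP : Function.Injective P)
    (hrange : Set.range P =
      {x : Fin s → K | ∀ i, x i = 0 ∨ ∃ u ∈ A i, (u : K) = x i})
    (r0 : ℕ) (hr0 : r0 = ∑ i, (e i - 1)) :
    (∀ dd : ℤ, -1 ≤ dd → dd < (r0 : ℤ) →
      dualCode (RMcodeZ P dd) = RMcodeZ P ((r0 : ℤ) - dd - 1)) ∧
    dualCode (RMcodeZ P (r0 : ℤ)) = ⊥ := by
  have hA (i : Fin s) : ((Nat.card (A i) + 1 : ℕ) : K) = 0 := by
    rw [CharP.cast_eq_zero_iff K p, ← hd, ← he]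
    exact hpe i
  obtain rfl : r0 = ∑ i, Nat.card (A i) := by simp [hr0, he, hd]
  have htop := RMcode_sum_card_eq_top hP hrange
  refine ⟨fun dd hlow hhigh => ?_, ?_⟩
  · rcases lt_or_ge dd 0 with hneg | hnonneg
    · obtain rfl : dd = -1 := by omega
      rw [RMcodeZ, if_pos (by norm_num), dualCode_bot, RMcodeZ, if_neg (by omega), ← htop]
      congr 1
      omega
    · lift dd to ℕ using hnonneg
      rw [RMcodeZ, if_neg (by omega), RMcodeZ, if_neg (by omega), Int.toNat_natCast,
        dualCode_RMcode hA hP hrange (by omega)]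
      congr 1
      omega
  · rw [RMcodeZ, if_neg (by omega), Int.toNat_natCast, htop, dualCode_top]

end
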